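/- arXiv:0807.3392 — 4 statements merged into one kernel-verified Lean document; each statement's English description precedes it below -/
import Mathlib

section
/- Let (μₙ) be a sequence of Borel probability measures on ℝ and let a < b be real numbers. Suppose that for each n the moment generating function Mₙ(t) = ∫ℝ e^{tx} dμₙ(x) is finite for every t ∈ (a,b). Then the following are equivalent: (i) there exists a Borel probability measure μ on ℝ whose moment generating function M(t) = ∫ℝ e^{tx} dμ(x) is finite for every t ∈ (a,b) and Mₙ(t) converges to M(t) for every t ∈ (a,b); (ii) for every t ∈ (a,b) one has sup over n of Mₙ(t) < ∞, and (μₙ) converges weakly to a Borel probability measure μ whose moment generating function M(t) = ∫ℝ e^{tx} dμ(x) is finite for every t ∈ (a,b). -/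
open MeasureTheory Filter Set BoundedContinuousFunction
open scoped Topology

/-- Interchange of limits: if `v k` approximates `u` up to arbitrarily small errors and each
`v k` converges to `w k`, where `w` converges to `a`, then `u` converges to `a`. -/
lemma tendsto_of_eventually_approx {ι : Type*} {l : Filter ι} {u : ι → ℝ} {v : ℕ → ι → ℝ}
    {w : ℕ → ℝ} {a : ℝ} (hv : ∀ k, Tendsto (v k) l (𝓝 (w k))) (hw : Tendsto w atTop (𝓝 a))
    (huv : ∀ ε > 0, ∀ᶠ k in atTop, ∀ᶠ i in l, |u i - v k i| ≤ ε) :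
    Tendsto u l (𝓝 a) := by
  rw [Metric.tendsto_nhds]
  intro ε hε
  obtain ⟨k, hk, hwk⟩ := ((huv (ε / 4) (by positivity)).and
    (Metric.tendsto_nhds.1 hw (ε / 4) (by positivity))).exists
  filter_upwards [hk, Metric.tendsto_nhds.1 (hv k) (ε / 4) (by positivity)] with i h1 h2
  rw [Real.dist_eq] at *
  rw [abs_le] at h1
  rw [abs_lt] at *
  constructor <;> linarith [h1.1, h1.2, h2.1, h2.2, hwk.1, hwk.2]

lemma sub_min_le_rpow_mul {y K r : ℝ} (hy : 0 ≤ y) (hK : 0 < K) (hr : 1 < r) :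
    y - min y K ≤ y ^ r * K ^ (1 - r) := by
  rcases le_or_gt y K with h | h
  · rw [min_eq_left h, sub_self]
    positivity
  · have hy' : 0 < y := hK.trans h
    calc y - min y K ≤ y := by
          rw [min_eq_right h.le]
          linarith
      _ = y ^ r * y ^ (1 - r) := by
          rw [← Real.rpow_add hy']
          simp
      _ ≤ y ^ r * K ^ (1 - r) := by
          gcongr ?_ * ?_
          exact Real.rpow_le_rpow_of_nonpos hK h.le (by linarith)

/-- Along a weakly convergent family of probability measures, the integrals of a nonnegative
continuous function with uniformly bounded moments of some order `r > 1` converge. -/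
lemma integrable_and_tendsto_integral_of_rpow_bounded {ι : Type*} {l : Filter ι} [l.NeBot]
    {ν : ι → Measure ℝ} [∀ i, IsProbabilityMeasure (ν i)] {ν₀ : Measure ℝ}
    [IsProbabilityMeasure ν₀]
    (hν : ∀ f : ℝ →ᵇ ℝ, Tendsto (fun i => ∫ x, f x ∂(ν i)) l (𝓝 (∫ x, f x ∂ν₀)))
    {g : ℝ → ℝ} (hg : Continuous g) (hg0 : ∀ x, 0 ≤ g x) {r C : ℝ} (hr : 1 < r)
    (hint : ∀ i, Integrable (fun x => g x ^ r) (ν i)) (hC : ∀ i, ∫ x, g x ^ r ∂(ν i) ≤ C) :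
    Integrable g ν₀ ∧ Tendsto (fun i => ∫ x, g x ∂(ν i)) l (𝓝 (∫ x, g x ∂ν₀)) := by
  let G (k : ℕ) : ℝ →ᵇ ℝ := BoundedContinuousFunction.ofNormedAddCommGroup
    (fun x => min (g x) k) (by fun_prop) k fun x => by
      rw [Real.norm_of_nonneg (le_min (hg0 x) k.cast_nonneg)]
      exact min_le_right _ _
  have hG (k : ℕ) (x : ℝ) : G k x = min (g x) k := rfl
  have hG0 (k : ℕ) (x : ℝ) : 0 ≤ G k x := le_min (hg0 x) k.cast_nonneg
  have hGlim (x : ℝ) : Tendsto (fun k => G k x) atTop (𝓝 (g x)) := by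
    refine tendsto_const_nhds.congr' ?_
    filter_upwards [eventually_ge_atTop ⌈g x⌉₊] with k hk
    rw [hG, min_eq_left ((Nat.le_ceil _).trans (by exact_mod_cast hk))]
  have hle (x : ℝ) : g x ≤ 1 + g x ^ r := by
    have := sub_min_le_rpow_mul (hg0 x) one_pos hr
    rw [Real.one_rpow, mul_one] at this
    linarith [min_le_right (g x) 1]
  have hgi (i : ι) : Integrable g (ν i) :=
    ((integrable_const 1).add (hint i)).mono' hg.aestronglyMeasurable <| .of_forall fun x => by
      rw [Real.norm_of_nonneg (hg0 x)]
      exact hle x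
  have hgC (i : ι) : ∫ x, g x ∂(ν i) ≤ 1 + C := by
    calc ∫ x, g x ∂(ν i) ≤ ∫ x, (1 + g x ^ r) ∂(ν i) :=
          integral_mono (hgi i) ((integrable_const 1).add (hint i)) hle
      _ ≤ 1 + C := by
          rw [integral_add (integrable_const 1) (hint i)]
          simpa using hC i
  have hGC (k : ℕ) : ∫ x, G k x ∂ν₀ ≤ 1 + C :=
    le_of_tendsto (hν (G k)) <| .of_forall fun i =>
      (integral_mono ((G k).integrable _) (hgi i) fun x => min_le_left _ _).trans (hgC i)
  have hg₀ : Integrable g ν₀ := by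
    refine integrable_of_tendsto (.of_forall hGlim)
      (fun k => (G k).continuous.aestronglyMeasurable) (ne_top_of_le_ne_top
        (ENNReal.ofReal_ne_top (r := 1 + C)) ?_)
    refine liminf_le_of_le (by isBoundedDefault) fun b hb => ?_
    obtain ⟨k, hk⟩ := hb.exists
    refine hk.trans ?_
    rw [← ofReal_integral_norm_eq_lintegral_enorm ((G k).integrable _)]
    refine ENNReal.ofReal_le_ofReal ((integral_congr_ae (.of_forall fun x => ?_)).trans_le (hGC k))
    exact Real.norm_of_nonneg (hG0 k x)
  refine ⟨hg₀, tendsto_of_eventually_approx (fun k => hν (G k))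
    (tendsto_integral_of_dominated_convergence g
      (fun k => (G k).continuous.aestronglyMeasurable) hg₀
      (fun k => .of_forall fun x => ?_) (.of_forall hGlim)) fun ε hε => ?_⟩
  · rw [Real.norm_of_nonneg (hG0 k x)]
    exact min_le_left _ _
  · have hlim : Tendsto (fun k : ℕ => C * (k : ℝ) ^ (1 - r)) atTop (𝓝 0) := by
      have := (tendsto_rpow_neg_atTop (y := r - 1) (by linarith)).comp tendsto_natCast_atTop_atTop
      simpa [Function.comp_def] using this.const_mul C
    filter_upwards [hlim.eventually_le_const hε, eventually_gt_atTop 0] with k hk hk0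
    refine .of_forall fun i => ?_
    rw [← integral_sub (hgi i) ((G k).integrable _),
      abs_of_nonneg (integral_nonneg fun x => sub_nonneg.2 (min_le_left _ _))]
    calc ∫ x, (g x - G k x) ∂(ν i) ≤ ∫ x, g x ^ r * (k : ℝ) ^ (1 - r) ∂(ν i) :=
          integral_mono ((hgi i).sub ((G k).integrable _)) ((hint i).mul_const _) fun x =>
            sub_min_le_rpow_mul (hg0 x) (by exact_mod_cast hk0) hr
      _ ≤ C * (k : ℝ) ^ (1 - r) := by
          rw [integral_mul_const]
          gcongr
          exact hC i
      _ ≤ ε := hk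

/-- Along a weakly convergent family of probability measures, pointwise bounded moment generating
functions on an open interval converge to that of the limit. -/
lemma integrable_exp_and_tendsto_of_bounded {ι : Type*} {l : Filter ι} [l.NeBot]
    {ν : ι → Measure ℝ} [∀ i, IsProbabilityMeasure (ν i)] {ν₀ : Measure ℝ}
    [IsProbabilityMeasure ν₀]
    (hν : ∀ f : ℝ →ᵇ ℝ, Tendsto (fun i => ∫ x, f x ∂(ν i)) l (𝓝 (∫ x, f x ∂ν₀)))
    {c d : ℝ} (hint : ∀ i, ∀ t ∈ Ioo c d, Integrable (fun x => Real.exp (t * x)) (ν i))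
    (hbdd : ∀ t ∈ Ioo c d, BddAbove (range fun i => ∫ x, Real.exp (t * x) ∂(ν i)))
    {t : ℝ} (ht : t ∈ Ioo c d) :
    Integrable (fun x => Real.exp (t * x)) ν₀ ∧
      Tendsto (fun i => ∫ x, Real.exp (t * x) ∂(ν i)) l (𝓝 (∫ x, Real.exp (t * x) ∂ν₀)) := by
  obtain ⟨r, hrt, hr⟩ : ∃ r, r * t ∈ Ioo c d ∧ 1 < r := by
    have hcont : Tendsto (fun r : ℝ => r * t) (𝓝[>] 1) (𝓝 t) := by
      have : ContinuousAt (fun r : ℝ => r * t) 1 := by fun_prop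
      simpa using this.tendsto.mono_left nhdsWithin_le_nhds
    exact ((hcont.eventually (isOpen_Ioo.mem_nhds ht)).and self_mem_nhdsWithin).exists
  have hexp (x : ℝ) : Real.exp (t * x) ^ r = Real.exp (r * t * x) := by
    rw [← Real.exp_mul]
    ring_nf
  obtain ⟨C, hC⟩ := hbdd _ hrt
  refine integrable_and_tendsto_integral_of_rpow_bounded hν (by fun_prop)
    (fun x => (Real.exp_pos _).le) hr (C := C) (fun i => ?_) fun i => ?_
  · simpa only [hexp] using hint i _ hrt
  · simpa only [hexp] using hC (mem_range_self i)

/-- Two probability measures whose moment generating functions are finite and coincide on an open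
interval containing `0` are equal. -/
lemma measure_eq_of_integral_exp_eq {ν ν' : Measure ℝ} [IsProbabilityMeasure ν]
    [IsProbabilityMeasure ν'] {c d : ℝ} (h0 : (0 : ℝ) ∈ Ioo c d)
    (hν : ∀ t ∈ Ioo c d, Integrable (fun x => Real.exp (t * x)) ν)
    (hν' : ∀ t ∈ Ioo c d, Integrable (fun x => Real.exp (t * x)) ν')
    (heq : ∀ t ∈ Ioo c d, ∫ x, Real.exp (t * x) ∂ν = ∫ x, Real.exp (t * x) ∂ν') :
    ν = ν' := by
  have hstrip {ρ : Measure ℝ} (hρ : ∀ t ∈ Ioo c d, Integrable (fun x => Real.exp (t * x)) ρ) :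
      AnalyticOnNhd ℂ (ProbabilityTheory.complexMGF id ρ) {z | z.re ∈ Ioo c d} :=
    ProbabilityTheory.analyticOnNhd_complexMGF.mono fun z hz =>
      interior_maximal (fun t ht => hρ t ht) isOpen_Ioo hz
  have hEq : EqOn (ProbabilityTheory.complexMGF id ν) (ProbabilityTheory.complexMGF id ν')
      {z | z.re ∈ Ioo c d} := by
    refine (hstrip hν).eqOn_of_preconnected_of_frequently_eq (hstrip hν')
      ((convex_Ioo c d).linear_preimage Complex.reLm).isPreconnected (z₀ := ((0 : ℝ) : ℂ))
      (by simpa using h0) ?_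
    have hmap : Tendsto ((↑) : ℝ → ℂ) (𝓝[≠] 0) (𝓝[≠] ((0 : ℝ) : ℂ)) :=
      Complex.continuous_ofReal.continuousAt.continuousWithinAt.tendsto_nhdsWithin
        fun x hx => by simpa using hx
    refine hmap.frequently (Eventually.frequently ?_)
    filter_upwards [nhdsWithin_le_nhds (isOpen_Ioo.mem_nhds h0)] with t ht
    rw [ProbabilityTheory.complexMGF_ofReal, ProbabilityTheory.complexMGF_ofReal]
    exact congrArg _ (heq t ht)
  refine Measure.ext_of_charFun (funext fun t => ?_)
  rw [← ProbabilityTheory.complexMGF_id_mul_I, ← ProbabilityTheory.complexMGF_id_mul_I]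
  exact hEq (by simpa using h0)

/-- A family of probability measures whose moment generating functions are bounded at `δ` and `-δ`
for some `δ > 0` is tight. -/
lemma isTightMeasureSet_range_of_integral_exp_le {ι : Type*} {ν : ι → Measure ℝ}
    [∀ i, IsProbabilityMeasure (ν i)] {δ C : ℝ} (hδ : 0 < δ)
    (hpos : ∀ i, Integrable (fun x => Real.exp (δ * x)) (ν i))
    (hneg : ∀ i, Integrable (fun x => Real.exp (-δ * x)) (ν i))
    (hposC : ∀ i, ∫ x, Real.exp (δ * x) ∂(ν i) ≤ C)
    (hnegC : ∀ i, ∫ x, Real.exp (-δ * x) ∂(ν i) ≤ C) :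
    IsTightMeasureSet (range ν) := by
  have hle (i : ι) (r : ℝ) : ν i {x | r < ‖x‖} ≤ ENNReal.ofReal (2 * C * Real.exp (-δ * r)) := by
    have h1 := ProbabilityTheory.measure_ge_le_exp_mul_mgf (X := id) (μ := ν i) r hδ.le (hpos i)
    have h2 := ProbabilityTheory.measure_le_le_exp_mul_mgf (X := id) (μ := ν i) (-r)
      (neg_nonpos.2 hδ.le) (hneg i)
    have hsub : {x : ℝ | r < ‖x‖} ⊆ {x | r ≤ id x} ∪ {x | id x ≤ -r} := by
      intro x hx
      rcases lt_abs.1 (show r < |x| from hx) with h | h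
      · exact Or.inl h.le
      · exact Or.inr (show x ≤ -r by linarith)
    rw [← ofReal_measureReal]
    refine ENNReal.ofReal_le_ofReal ?_
    calc (ν i).real {x | r < ‖x‖}
        ≤ (ν i).real {x | r ≤ id x} + (ν i).real {x | id x ≤ -r} :=
          (measureReal_mono hsub).trans (measureReal_union_le _ _)
      _ ≤ Real.exp (-δ * r) * C + Real.exp (-δ * r) * C := by
          refine add_le_add (h1.trans ?_) (h2.trans ?_)
          · gcongr
            exact hposC i
          · rw [show - -δ * -r = -δ * r by ring]
            gcongr
            exact hnegC i
      _ = 2 * C * Real.exp (-δ * r) := by ring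
  refine isTightMeasureSet_of_tendsto_measure_norm_gt ?_
  have hlim : Tendsto (fun r : ℝ => ENNReal.ofReal (2 * C * Real.exp (-δ * r))) atTop (𝓝 0) := by
    have h : Tendsto (fun r : ℝ => -δ * r) atTop atBot :=
      tendsto_id.const_mul_atTop_of_neg (neg_lt_zero.2 hδ)
    simpa using ENNReal.tendsto_ofReal ((Real.tendsto_exp_atBot.comp h).const_mul (2 * C))
  refine tendsto_of_tendsto_of_tendsto_of_le_of_le tendsto_const_nhds hlim (fun _ => zero_le) ?_
  intro r
  refine iSup₂_le ?_
  rintro _ ⟨i, rfl⟩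
  exact hle i r

/-- **Curtiss' theorem**: convergence of moment generating functions on an open interval
containing `0` implies weak convergence. -/
lemma tendsto_integral_of_tendsto_integral_exp {ν : ℕ → Measure ℝ}
    [∀ n, IsProbabilityMeasure (ν n)] {ν₀ : Measure ℝ} [IsProbabilityMeasure ν₀]
    {c d : ℝ} (h0 : (0 : ℝ) ∈ Ioo c d)
    (hν : ∀ n, ∀ t ∈ Ioo c d, Integrable (fun x => Real.exp (t * x)) (ν n))
    (hν₀ : ∀ t ∈ Ioo c d, Integrable (fun x => Real.exp (t * x)) ν₀)
    (hlim : ∀ t ∈ Ioo c d, Tendsto (fun n => ∫ x, Real.exp (t * x) ∂(ν n)) atTop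
      (𝓝 (∫ x, Real.exp (t * x) ∂ν₀))) (f : ℝ →ᵇ ℝ) :
    Tendsto (fun n => ∫ x, f x ∂(ν n)) atTop (𝓝 (∫ x, f x ∂ν₀)) := by
  have hbdd (t : ℝ) (ht : t ∈ Ioo c d) :
      BddAbove (range fun n => ∫ x, Real.exp (t * x) ∂(ν n)) := (hlim t ht).bddAbove_range
  have htight : IsTightMeasureSet (range ν) := by
    obtain ⟨δ, hδ0, hδ⟩ := exists_between (lt_min (neg_pos.2 h0.1) h0.2)
    rw [lt_min_iff] at hδ
    have hp : δ ∈ Ioo c d := ⟨h0.1.trans hδ0, hδ.2⟩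
    have hn : -δ ∈ Ioo c d := ⟨by linarith [hδ.1], by linarith [h0.2]⟩
    obtain ⟨C, hC⟩ := hbdd _ hp
    obtain ⟨D, hD⟩ := hbdd _ hn
    exact isTightMeasureSet_range_of_integral_exp_le (C := max C D) hδ0 (fun n => hν n _ hp)
      (fun n => hν n _ hn) (fun n => (hC (mem_range_self n)).trans (le_max_left _ _))
      fun n => (hD (mem_range_self n)).trans (le_max_right _ _)
  let P (n : ℕ) : ProbabilityMeasure ℝ := ⟨ν n, inferInstance⟩
  let P₀ : ProbabilityMeasure ℝ := ⟨ν₀, inferInstance⟩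
  suffices Tendsto P atTop (𝓝 P₀) from
    ProbabilityMeasure.tendsto_iff_forall_integral_tendsto.1 this f
  refine (Filter.tendsto_iff_ultrafilter _ _ _).2 fun U hU => ?_
  have hcompact : IsCompact (closure (range P)) := by
    refine isCompact_closure_of_isTightMeasureSet (htight.subset ?_)
    rintro _ ⟨_, ⟨n, rfl⟩, rfl⟩
    exact mem_range_self n
  obtain ⟨Q, -, hQ : Tendsto P U (𝓝 Q)⟩ := hcompact.ultrafilter_le_nhds (U.map P)
    (tendsto_principal.2 (.of_forall fun n => subset_closure (mem_range_self n)))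
  have hQint := ProbabilityMeasure.tendsto_iff_forall_integral_tendsto.1 hQ
  have hQexp {t : ℝ} (ht : t ∈ Ioo c d) := integrable_exp_and_tendsto_of_bounded
    (ν := ν) (ν₀ := (Q : Measure ℝ)) hQint hν hbdd ht
  have hQeq : (Q : Measure ℝ) = ν₀ := measure_eq_of_integral_exp_eq h0
    (fun t ht => (hQexp ht).1) hν₀ fun t ht =>
      tendsto_nhds_unique (hQexp ht).2 ((hlim t ht).mono_left hU)
  rwa [show P₀ = Q from Subtype.ext hQeq.symm]

/-- Convergence of moment generating functions on a nonempty open interval, not necessarily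
containing `0`, implies weak convergence. -/
lemma tendsto_integral_of_tendsto_integral_exp_Ioo {μ : ℕ → Measure ℝ}
    [∀ n, IsProbabilityMeasure (μ n)] {ν : Measure ℝ} [IsProbabilityMeasure ν]
    {a b : ℝ} (hab : a < b)
    (hμ : ∀ n, ∀ t ∈ Ioo a b, Integrable (fun x => Real.exp (t * x)) (μ n))
    (hν : ∀ t ∈ Ioo a b, Integrable (fun x => Real.exp (t * x)) ν)
    (hlim : ∀ t ∈ Ioo a b, Tendsto (fun n => ∫ x, Real.exp (t * x) ∂(μ n)) atTop
      (𝓝 (∫ x, Real.exp (t * x) ∂ν))) (f : ℝ →ᵇ ℝ) :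
    Tendsto (fun n => ∫ x, f x ∂(μ n)) atTop (𝓝 (∫ x, f x ∂ν)) := by
  obtain ⟨s, hs⟩ := exists_between hab
  have hmem {t : ℝ} (ht : t ∈ Ioo (a - s) (b - s)) : s + t ∈ Ioo a b :=
    ⟨by linarith [ht.1], by linarith [ht.2]⟩
  let T (ρ : Measure ℝ) : Measure ℝ := ρ.tilted (s * ·)
  have hTprob (n : ℕ) : IsProbabilityMeasure (T (μ n)) := isProbabilityMeasure_tilted (hμ n s hs)
  have hTprob₀ : IsProbabilityMeasure (T ν) := isProbabilityMeasure_tilted (hν s hs)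
  have hTint {ρ : Measure ℝ} (hρ : ∀ t ∈ Ioo a b, Integrable (fun x => Real.exp (t * x)) ρ)
      (t : ℝ) (ht : t ∈ Ioo (a - s) (b - s)) : Integrable (fun x => Real.exp (t * x)) (T ρ) := by
    refine (integrable_tilted_iff (hρ s hs) _).2 ((hρ _ (hmem ht)).congr (.of_forall fun x => ?_))
    simp only [smul_eq_mul, ← Real.exp_add, add_mul]
  have hTexp (ρ : Measure ℝ) (t : ℝ) : ∫ x, Real.exp (t * x) ∂(T ρ) =
      (∫ x, Real.exp ((s + t) * x) ∂ρ) / ∫ x, Real.exp (s * x) ∂ρ := by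
    simp only [T, integral_exp_tilted, Pi.add_apply, add_mul]
  have hweak := tendsto_integral_of_tendsto_integral_exp (ν := fun n => T (μ n)) (ν₀ := T ν)
    (c := a - s) (d := b - s) ⟨by linarith [hs.1], by linarith [hs.2]⟩
    (fun n => hTint (hμ n)) (hTint hν) fun t ht => by
      simp only [hTexp]
      exact (hlim _ (hmem ht)).div (hlim s hs) (integral_exp_pos (hν s hs)).ne'
  let χ (k : ℕ) (x : ℝ) : ℝ := min 1 (k * Real.exp (s * x))
  have hχcont (k : ℕ) : Continuous (χ k) := by fun_prop
  have hχ0 (k : ℕ) (x : ℝ) : 0 ≤ χ k x := by positivity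
  have hχ1 (k : ℕ) (x : ℝ) : χ k x ≤ 1 := min_le_left _ _
  have hχlim (x : ℝ) : Tendsto (fun k => χ k x) atTop (𝓝 1) := by
    refine tendsto_const_nhds.congr' ?_
    have := tendsto_natCast_atTop_atTop.atTop_mul_const (Real.exp_pos (s * x))
    filter_upwards [this.eventually_ge_atTop 1] with k hk using (min_eq_left hk).symm
  let H (h : ℝ →ᵇ ℝ) (k : ℕ) : ℝ →ᵇ ℝ := h * BoundedContinuousFunction.ofNormedAddCommGroup
    (fun x => min (Real.exp (-(s * x))) k) (by fun_prop) k fun x => by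
      rw [Real.norm_of_nonneg (by positivity)]
      exact min_le_right _ _
  have hH (ρ : Measure ℝ) [NeZero ρ] (hρ : Integrable (fun x => Real.exp (s * x)) ρ)
      (h : ℝ →ᵇ ℝ) (k : ℕ) :
      ∫ x, h x * χ k x ∂ρ = (∫ x, Real.exp (s * x) ∂ρ) * ∫ x, H h k x ∂(T ρ) := by
    have hne := (integral_exp_pos hρ).ne'
    rw [integral_tilted, ← integral_const_mul]
    refine integral_congr_ae (.of_forall fun x => ?_)
    have hx : χ k x = Real.exp (s * x) * min (Real.exp (-(s * x))) k := by
      rw [mul_min_of_nonneg _ _ (Real.exp_pos _).le, ← Real.exp_add, add_neg_cancel,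
        Real.exp_zero, mul_comm]
    change h x * χ k x = _ * (_ • (h x * min (Real.exp (-(s * x))) k))
    rw [hx, smul_eq_mul]
    field_simp
  have hχweak (h : ℝ →ᵇ ℝ) (k : ℕ) :
      Tendsto (fun n => ∫ x, h x * χ k x ∂(μ n)) atTop (𝓝 (∫ x, h x * χ k x ∂ν)) := by
    rw [hH ν (hν s hs)]
    simp only [hH (μ _) (hμ _ s hs)]
    exact (hlim s hs).mul (hweak _)
  have hbound (h : ℝ →ᵇ ℝ) (k : ℕ) (x : ℝ) : ‖h x * χ k x‖ ≤ ‖h‖ := by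
    rw [norm_mul, Real.norm_of_nonneg (hχ0 k x)]
    exact (mul_le_of_le_one_right (norm_nonneg _) (hχ1 k x)).trans (h.norm_coe_le_norm x)
  have hcutlim (h : ℝ →ᵇ ℝ) :
      Tendsto (fun k => ∫ x, h x * χ k x ∂ν) atTop (𝓝 (∫ x, h x ∂ν)) :=
    tendsto_integral_of_dominated_convergence (fun _ => ‖h‖)
      (fun k => (h.continuous.mul (hχcont k)).aestronglyMeasurable) (integrable_const _)
      (fun k => .of_forall (hbound h k))
      (.of_forall fun x => by simpa using (hχlim x).const_mul (h x))
  have hint (h : ℝ →ᵇ ℝ) (k n : ℕ) : Integrable (fun x => h x * χ k x) (μ n) :=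
    (integrable_const ‖h‖).mono' (h.continuous.mul (hχcont k)).aestronglyMeasurable
      (.of_forall (hbound h k))
  have hχint (k n : ℕ) : Integrable (χ k) (μ n) := by simpa using hint 1 k n
  refine tendsto_of_eventually_approx (hχweak f) (hcutlim f) fun ε hε => ?_
  have hmass : Tendsto (fun k => ‖f‖ * (1 - ∫ x, χ k x ∂ν)) atTop (𝓝 0) := by
    simpa using ((hcutlim 1).const_sub 1).const_mul ‖f‖
  filter_upwards [hmass.eventually_lt_const hε] with k hk
  have hmassn : Tendsto (fun n => ‖f‖ * (1 - ∫ x, χ k x ∂(μ n))) atTop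
      (𝓝 (‖f‖ * (1 - ∫ x, χ k x ∂ν))) := by
    simpa using ((hχweak 1 k).const_sub 1).const_mul ‖f‖
  filter_upwards [hmassn.eventually_lt_const hk] with n hn
  refine le_trans ?_ hn.le
  rw [← integral_sub (f.integrable _) (hint f k n), ← Real.norm_eq_abs]
  calc ‖∫ x, (f x - f x * χ k x) ∂(μ n)‖ ≤ ∫ x, ‖f‖ * (1 - χ k x) ∂(μ n) := by
        refine norm_integral_le_of_norm_le
          (((integrable_const 1).sub (hχint k n)).const_mul _) (.of_forall fun x => ?_)
        rw [← mul_one_sub, norm_mul, Real.norm_of_nonneg (sub_nonneg.2 (hχ1 k x))]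
        exact mul_le_mul_of_nonneg_right (f.norm_coe_le_norm x) (sub_nonneg.2 (hχ1 k x))
    _ = ‖f‖ * (1 - ∫ x, χ k x ∂(μ n)) := by
        rw [integral_const_mul, integral_sub (integrable_const 1) (hχint k n)]
        simp

/-- Theorem 1 (Chareka): a sequence of mgfs, each finite on `(a,b)`, converges on `(a,b)`
to the mgf of a probability measure (finite on `(a,b)`) iff the mgfs are pointwise bounded
on `(a,b)` and the measures converge weakly to a probability measure whose mgf is finite
on `(a,b)`. -/
theorem curtiss_converse_one_sided_iff
    (μ : ℕ → Measure ℝ) (hprob : ∀ n, IsProbabilityMeasure (μ n))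
    (a b : ℝ) (hab : a < b)
    (hfin : ∀ n, ∀ t ∈ Ioo a b, Integrable (fun x => Real.exp (t * x)) (μ n)) :
    (∃ ν : Measure ℝ, IsProbabilityMeasure ν ∧
        (∀ t ∈ Ioo a b, Integrable (fun x => Real.exp (t * x)) ν) ∧
        (∀ t ∈ Ioo a b,
          Tendsto (fun n => ∫ x, Real.exp (t * x) ∂(μ n)) atTop
            (nhds (∫ x, Real.exp (t * x) ∂ν)))) ↔
      ((∀ t ∈ Ioo a b,
          BddAbove (Set.range fun n => ∫ x, Real.exp (t * x) ∂(μ n))) ∧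
        (∃ ν : Measure ℝ, IsProbabilityMeasure ν ∧
          (∀ f : ℝ →ᵇ ℝ,
            Tendsto (fun n => ∫ x, f x ∂(μ n)) atTop (nhds (∫ x, f x ∂ν))) ∧
          (∀ t ∈ Ioo a b, Integrable (fun x => Real.exp (t * x)) ν))) := by
  constructor
  · rintro ⟨ν, hν, hνint, hlim⟩
    exact ⟨fun t ht => (hlim t ht).bddAbove_range, ν, hν,
      tendsto_integral_of_tendsto_integral_exp_Ioo hab hfin hνint hlim, hνint⟩
  · rintro ⟨hbdd, ν, hν, hweak, hνint⟩
    exact ⟨ν, hν, hνint, fun t ht =>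
      (integrable_exp_and_tendsto_of_bounded hweak hfin hbdd ht).2⟩
end

section
/- (Sufficiency direction of Theorem 1.) Let (μₙ) be a sequence of Borel probability measures on ℝ and let a < b be real numbers. Suppose that for each n the moment generating function Mₙ(t) = ∫ℝ e^{tx} dμₙ(x) is finite for every t ∈ (a,b), that for every t ∈ (a,b) one has sup over n of Mₙ(t) < ∞, and that (μₙ) converges weakly to a Borel probability measure μ whose moment generating function M(t) = ∫ℝ e^{tx} dμ(x) is finite for every t ∈ (a,b). Then Mₙ(t) converges to M(t) for every t ∈ (a,b). -/
open MeasureTheory Filter Set BoundedContinuousFunction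

/-- The exponential `x ↦ exp (t * x)` truncated at height `exp k`, as a bounded continuous
function. -/
noncomputable def truncExp (t k : ℝ) : ℝ →ᵇ ℝ :=
  BoundedContinuousFunction.ofNormedAddCommGroup
    (fun x => min (Real.exp (t * x)) (Real.exp k)) (by fun_prop) (Real.exp k) (by
      intro x
      rw [Real.norm_of_nonneg (le_min (Real.exp_pos _).le (Real.exp_pos _).le)]
      exact min_le_right _ _)

lemma truncExp_apply (t k x : ℝ) :
    truncExp t k x = min (Real.exp (t * x)) (Real.exp k) := rfl

lemma exp_sub_truncExp_le {δ : ℝ} (hδ : 0 ≤ δ) (t k x : ℝ) :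
    Real.exp (t * x) - truncExp t k x ≤
      Real.exp (-(δ * k)) * Real.exp ((1 + δ) * t * x) := by
  rw [truncExp_apply, ← Real.exp_add]
  rcases le_total (t * x) k with h | h
  · rw [min_eq_left (Real.exp_le_exp.2 h), sub_self]
    positivity
  · have : Real.exp (t * x) ≤ Real.exp (-(δ * k) + (1 + δ) * t * x) :=
      Real.exp_le_exp.2 (by nlinarith [mul_le_mul_of_nonneg_left h hδ])
    have hpos : 0 ≤ min (Real.exp (t * x)) (Real.exp k) :=
      le_min (Real.exp_pos _).le (Real.exp_pos _).le
    linarith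

/-- Truncating at height `exp k` changes the moment generating function at `t` by at most
`exp (-(δ * k))` times its value at `(1 + δ) * t`. -/
lemma abs_integral_exp_sub_integral_truncExp_le {δ : ℝ} (hδ : 0 ≤ δ) (t k : ℝ)
    (ρ : Measure ℝ) [IsFiniteMeasure ρ] (ht : Integrable (fun x => Real.exp (t * x)) ρ)
    (hs : Integrable (fun x => Real.exp ((1 + δ) * t * x)) ρ) :
    |∫ x, Real.exp (t * x) ∂ρ - ∫ x, truncExp t k x ∂ρ| ≤
      Real.exp (-(δ * k)) * ∫ x, Real.exp ((1 + δ) * t * x) ∂ρ := by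
  have htrunc : Integrable (fun x => truncExp t k x) ρ := (truncExp t k).integrable ρ
  rw [← integral_sub ht htrunc, ← integral_const_mul, abs_of_nonneg]
  · exact integral_mono (ht.sub htrunc) (hs.const_mul _) (exp_sub_truncExp_le hδ t k)
  · exact integral_nonneg fun x => sub_nonneg.2 (min_le_left _ _)

/-- Sufficiency direction of Theorem 1: if the mgfs are finite and pointwise bounded on
`(a,b)` and the measures converge weakly to a probability measure `ν` whose mgf is finite
on `(a,b)`, then the mgfs converge to the mgf of `ν` on `(a,b)`. -/
theorem curtiss_converse_one_sided_sufficiency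
    (μ : ℕ → Measure ℝ) (hprob : ∀ n, IsProbabilityMeasure (μ n))
    (a b : ℝ) (hab : a < b)
    (hfin : ∀ n, ∀ t ∈ Ioo a b, Integrable (fun x => Real.exp (t * x)) (μ n))
    (hbdd : ∀ t ∈ Ioo a b,
      BddAbove (Set.range fun n => ∫ x, Real.exp (t * x) ∂(μ n)))
    (ν : Measure ℝ) (hν : IsProbabilityMeasure ν)
    (hweak : ∀ f : ℝ →ᵇ ℝ,
      Tendsto (fun n => ∫ x, f x ∂(μ n)) atTop (nhds (∫ x, f x ∂ν)))
    (hνfin : ∀ t ∈ Ioo a b, Integrable (fun x => Real.exp (t * x)) ν) :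
    ∀ t ∈ Ioo a b,
      Tendsto (fun n => ∫ x, Real.exp (t * x) ∂(μ n)) atTop
        (nhds (∫ x, Real.exp (t * x) ∂ν)) := by
  intro t ht
  obtain ⟨δ, hδ, hs⟩ : ∃ δ : ℝ, 0 < δ ∧ (1 + δ) * t ∈ Ioo a b := by
    have hcont : Tendsto (fun δ : ℝ => (1 + δ) * t) (nhdsWithin 0 (Ioi 0)) (nhds t) :=
      (Continuous.tendsto' (by fun_prop) 0 t (by simp)).mono_left nhdsWithin_le_nhds
    exact ((eventually_mem_nhdsWithin (a := (0 : ℝ)) (s := Ioi 0)).and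
      (hcont (Ioo_mem_nhds ht.1 ht.2))).exists
  obtain ⟨C, hC⟩ := hbdd _ hs
  set D := max C (∫ x, Real.exp ((1 + δ) * t * x) ∂ν)
  rw [Metric.tendsto_atTop]
  intro ε hε
  have hsmall : Tendsto (fun k : ℝ => Real.exp (-(δ * k)) * D) atTop (nhds 0) := by
    simpa using (Real.tendsto_exp_neg_atTop_nhds_zero.comp
      (tendsto_id.const_mul_atTop hδ)).mul_const D
  obtain ⟨k, hk⟩ := (hsmall.eventually_lt_const (by positivity : 0 < ε / 3)).exists
  obtain ⟨N, hN⟩ := Metric.tendsto_atTop.1 (hweak (truncExp t k)) (ε / 3) (by positivity)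
  refine ⟨N, fun n hn => ?_⟩
  have hμ := (abs_integral_exp_sub_integral_truncExp_le hδ.le t k (μ n) (hfin n t ht)
    (hfin n _ hs)).trans (mul_le_mul_of_nonneg_left
      ((hC (mem_range_self n)).trans (le_max_left _ _ : C ≤ D)) (Real.exp_pos _).le)
  have hν' := (abs_integral_exp_sub_integral_truncExp_le hδ.le t k ν (hνfin t ht)
    (hνfin _ hs)).trans (mul_le_mul_of_nonneg_left (le_max_right _ _ : _ ≤ D)
      (Real.exp_pos _).le)
  have hmid := hN n hn
  rw [Real.dist_eq, abs_lt] at *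
  rw [abs_le] at hμ hν'
  constructor <;> linarith [hμ.1, hμ.2, hν'.1, hν'.2, hmid.1, hmid.2]
end

section
/- For each n ≥ 1 and each real t, let Mₙ(t) = ∫_{1/n}^∞ x⁻² (1 - 1/(n x))^{n-1} e^{t x} dx be the moment generating function of the distribution with distribution function Fₙ(x) = (1 - 1/(n x))ⁿ for x > 1/n and 0 otherwise. Then for every t ≤ 0, Mₙ(t) is finite for every n, sup over n of Mₙ(t) < ∞, and as n → ∞ one has Mₙ(t) → ∫₀^∞ x⁻² exp(-1/x + t x) dx, the moment generating function of the standard Fréchet distribution at t. -/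
open MeasureTheory Filter Set

/-- The density of `Fₙ` is dominated by a multiple of the Cauchy density, uniformly in `n`. -/
lemma pareto_density_le (n : ℕ) (hn : 1 ≤ n) (x : ℝ) (hx : 1 / (n : ℝ) < x) :
    x ^ (-2 : ℤ) * (1 - 1 / ((n : ℝ) * x)) ^ (n - 1) ≤ 2 * Real.exp 1 * (1 + x ^ 2)⁻¹ := by
  have hn0 : (0 : ℝ) < n := by exact_mod_cast hn
  have hx0 : 0 < x := lt_trans (by positivity) hx
  have hle : 1 / ((n : ℝ) * x) ≤ 1 := by
    rw [div_lt_iff₀ hn0] at hx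
    rw [div_le_one (by positivity)]
    linarith
  have hpow : (1 - 1 / ((n : ℝ) * x)) ^ (n - 1) ≤ Real.exp 1 * (Real.exp (1 / x))⁻¹ := by
    calc (1 - 1 / ((n : ℝ) * x)) ^ (n - 1)
        ≤ Real.exp (-(1 / ((n : ℝ) * x))) ^ (n - 1) := by
          gcongr
          exact Real.one_sub_le_exp_neg _
      _ = Real.exp (1 / ((n : ℝ) * x) - 1 / x) := by
          rw [← Real.exp_nat_mul]
          congr 1
          push_cast [hn]
          field_simp
          ring
      _ ≤ Real.exp (1 - 1 / x) := by gcongr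
      _ = Real.exp 1 * (Real.exp (1 / x))⁻¹ := by rw [Real.exp_sub, div_eq_mul_inv]
  have hexp : (1 + x ^ 2) / 2 ≤ x ^ 2 * Real.exp (1 / x) := by
    have hquad := Real.quadratic_le_exp_of_nonneg (x := 1 / x) (by positivity)
    calc (1 + x ^ 2) / 2 ≤ x ^ 2 * (1 + 1 / x + (1 / x) ^ 2 / 2) := by
          field_simp
          nlinarith
      _ ≤ _ := by gcongr
  calc x ^ (-2 : ℤ) * (1 - 1 / ((n : ℝ) * x)) ^ (n - 1)
      ≤ x ^ (-2 : ℤ) * (Real.exp 1 * (Real.exp (1 / x))⁻¹) := by gcongr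
    _ = Real.exp 1 * (x ^ 2 * Real.exp (1 / x))⁻¹ := by
        rw [zpow_neg, mul_inv]
        norm_cast
        ring
    _ ≤ Real.exp 1 * ((1 + x ^ 2) / 2)⁻¹ := by gcongr
    _ = 2 * Real.exp 1 * (1 + x ^ 2)⁻¹ := by
        rw [inv_div]
        ring

lemma norm_pareto_mgf_integrand_le {t : ℝ} (ht : t ≤ 0) (n : ℕ) (hn : 1 ≤ n) (x : ℝ)
    (hx : 1 / (n : ℝ) < x) :
    ‖x ^ (-2 : ℤ) * (1 - 1 / ((n : ℝ) * x)) ^ (n - 1) * Real.exp (t * x)‖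
      ≤ 2 * Real.exp 1 * (1 + x ^ 2)⁻¹ := by
  have hn0 : (0 : ℝ) < n := by exact_mod_cast hn
  have hx0 : 0 < x := lt_trans (by positivity) hx
  have hle : 0 ≤ 1 - 1 / ((n : ℝ) * x) := by
    rw [div_lt_iff₀ hn0] at hx
    rw [sub_nonneg, div_le_one (by positivity)]
    linarith
  rw [Real.norm_of_nonneg (by positivity)]
  have hexp : Real.exp (t * x) ≤ 1 :=
    Real.exp_le_one_iff.2 (mul_nonpos_of_nonpos_of_nonneg ht hx0.le)
  exact (mul_le_of_le_one_right (by positivity) hexp).trans (pareto_density_le n hn x hx)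

lemma tendsto_one_sub_pow_exp (x : ℝ) :
    Tendsto (fun n : ℕ => (1 - 1 / ((n : ℝ) * x)) ^ (n - 1)) atTop
      (nhds (Real.exp (-(1 / x)))) := by
  have hpow := Real.tendsto_one_add_div_pow_exp (-(1 / x))
  have hbase : Tendsto (fun n : ℕ => 1 + -(1 / x) / (n : ℝ)) atTop (nhds 1) := by
    simpa using (tendsto_const_div_atTop_nhds_zero_nat (-(1 / x))).const_add 1
  have hdiv := hpow.div hbase one_ne_zero
  rw [div_one] at hdiv
  refine hdiv.congr' ?_
  filter_upwards [eventually_ge_atTop 1, hbase.eventually_ne one_ne_zero] with n hn hne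
  have heq : 1 - 1 / ((n : ℝ) * x) = 1 + -(1 / x) / (n : ℝ) := by
    rw [neg_div, div_div, mul_comm x, sub_eq_add_neg]
  rw [heq, Pi.div_apply, div_eq_iff hne, ← pow_succ, Nat.sub_add_cancel hn]

/-- For `t ≤ 0`, the mgfs `Mₙ(t) = ∫_{1/n}^∞ x⁻² (1 - 1/(n x))^{n-1} e^{t x} dx` of the
distributions `Fₙ` are finite, uniformly bounded in `n`, and converge as `n → ∞` to the
mgf `∫₀^∞ x⁻² exp (-1/x + t x) dx` of the standard Fréchet distribution. -/
theorem mgf_pareto_tendsto_frechet_mgf :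
    ∀ t : ℝ, t ≤ 0 →
      (∀ n : ℕ, 1 ≤ n →
        IntegrableOn
          (fun x : ℝ => x ^ (-2 : ℤ) * (1 - 1 / ((n : ℝ) * x)) ^ (n - 1) * Real.exp (t * x))
          (Ioi (1 / (n : ℝ)))) ∧
      (∃ C : ℝ, ∀ n : ℕ, 1 ≤ n →
        (∫ x in Ioi (1 / (n : ℝ)),
          x ^ (-2 : ℤ) * (1 - 1 / ((n : ℝ) * x)) ^ (n - 1) * Real.exp (t * x)) ≤ C) ∧
      Tendsto
        (fun n : ℕ => ∫ x in Ioi (1 / (n : ℝ)),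
          x ^ (-2 : ℤ) * (1 - 1 / ((n : ℝ) * x)) ^ (n - 1) * Real.exp (t * x))
        atTop
        (nhds (∫ x in Ioi (0 : ℝ), x ^ (-2 : ℤ) * Real.exp (-(1 / x) + t * x))) := by
  intro t ht
  have hdom : Integrable (fun x : ℝ => 2 * Real.exp 1 * (1 + x ^ 2)⁻¹) :=
    integrable_inv_one_add_sq.const_mul _
  have hmeas (n : ℕ) : Measurable (fun x : ℝ =>
      x ^ (-2 : ℤ) * (1 - 1 / ((n : ℝ) * x)) ^ (n - 1) * Real.exp (t * x)) := by
    fun_prop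
  have hint (n : ℕ) (hn : 1 ≤ n) : IntegrableOn
      (fun x : ℝ => x ^ (-2 : ℤ) * (1 - 1 / ((n : ℝ) * x)) ^ (n - 1) * Real.exp (t * x))
      (Ioi (1 / (n : ℝ))) := by
    refine hdom.integrableOn.mono' (hmeas n).aestronglyMeasurable ?_
    filter_upwards [ae_restrict_mem measurableSet_Ioi] with x hx
    exact norm_pareto_mgf_integrand_le ht n hn x hx
  refine ⟨hint, ⟨∫ x : ℝ, 2 * Real.exp 1 * (1 + x ^ 2)⁻¹, fun n hn => ?_⟩, ?_⟩
  · calc _ ≤ ∫ x in Ioi (1 / (n : ℝ)), 2 * Real.exp 1 * (1 + x ^ 2)⁻¹ :=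
          setIntegral_mono_on (hint n hn) hdom.integrableOn measurableSet_Ioi fun x hx =>
            (Real.le_norm_self _).trans (norm_pareto_mgf_integrand_le ht n hn x hx)
      _ ≤ _ := setIntegral_le_integral hdom (ae_of_all _ fun x => by positivity)
  · simp_rw [← integral_indicator (measurableSet_Ioi (α := ℝ))]
    refine tendsto_integral_filter_of_dominated_convergence _
      (Eventually.of_forall fun n =>
        ((hmeas n).indicator measurableSet_Ioi).aestronglyMeasurable) ?_ hdom ?_
    · filter_upwards [eventually_ge_atTop 1] with n hn
      refine ae_of_all _ fun x => ?_
      by_cases hx : x ∈ Ioi (1 / (n : ℝ))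
      · rw [indicator_of_mem hx]
        exact norm_pareto_mgf_integrand_le ht n hn x hx
      · rw [indicator_of_notMem hx, norm_zero]
        positivity
    · refine ae_of_all _ fun x => ?_
      by_cases hx : x ∈ Ioi (0 : ℝ)
      · rw [indicator_of_mem hx, Real.exp_add, ← mul_assoc]
        refine (((tendsto_one_sub_pow_exp x).const_mul _).mul_const _).congr' ?_
        filter_upwards [tendsto_one_div_atTop_nhds_zero_nat.eventually_lt_const (mem_Ioi.1 hx)] with n hn
        rw [indicator_of_mem (mem_Ioi.2 hn)]
      · rw [indicator_of_notMem hx]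
        refine tendsto_const_nhds.congr fun n => ?_
        rw [indicator_of_notMem]
        exact fun hn => hx (lt_of_le_of_lt (by positivity) (mem_Ioi.1 hn))
end

section
/- (Finite-interval uniqueness theorem for moment generating functions, used in the proof of Theorem 1.) Let μ and ν be Borel probability measures on ℝ and let a < b be real numbers. If the moment generating functions ∫ℝ e^{tx} dμ(x) and ∫ℝ e^{tx} dν(x) are both finite and equal for every t ∈ (a,b), then μ = ν. -/
open MeasureTheory Filter Set

/-- If the moment generating functions of two real random variables are finite and agree on an
open interval, then the complex moment generating functions agree on the vertical strip above
that interval. -/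
theorem eqOn_complexMGF_of_eqOn_mgf_Ioo {Ω Ω' : Type*} {mΩ : MeasurableSpace Ω}
    {mΩ' : MeasurableSpace Ω'} {X : Ω → ℝ} {Y : Ω' → ℝ} {μ : Measure Ω} {ν : Measure Ω'} {a b : ℝ}
    (hμ : Ioo a b ⊆ ProbabilityTheory.integrableExpSet X μ)
    (hν : Ioo a b ⊆ ProbabilityTheory.integrableExpSet Y ν)
    (h : EqOn (ProbabilityTheory.mgf X μ) (ProbabilityTheory.mgf Y ν) (Ioo a b)) :
    EqOn (ProbabilityTheory.complexMGF X μ) (ProbabilityTheory.complexMGF Y ν)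
      (Complex.re ⁻¹' Ioo a b) := by
  rcases (Ioo a b).eq_empty_or_nonempty with h_empty | ⟨t, ht⟩
  · simp [h_empty]
  refine AnalyticOnNhd.eqOn_of_preconnected_of_frequently_eq
    (ProbabilityTheory.analyticOnNhd_complexMGF.mono
      fun z hz ↦ interior_maximal hμ isOpen_Ioo hz)
    (ProbabilityTheory.analyticOnNhd_complexMGF.mono
      fun z hz ↦ interior_maximal hν isOpen_Ioo hz)
    ((convex_Ioo a b).linear_preimage Complex.reLm).isPreconnected
    (z₀ := (t : ℂ)) (by simpa using ht) ?_
  have h_tendsto : Tendsto ((↑) : ℝ → ℂ) (nhdsWithin t {t}ᶜ) (nhdsWithin (t : ℂ) {(t : ℂ)}ᶜ) :=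
    Complex.continuous_ofReal.continuousAt.continuousWithinAt.tendsto_nhdsWithin
      fun x hx ↦ by simpa using hx
  refine h_tendsto.frequently (Eventually.frequently ?_)
  filter_upwards [nhdsWithin_le_nhds (isOpen_Ioo.mem_nhds ht)] with x hx
  rw [ProbabilityTheory.complexMGF_ofReal, ProbabilityTheory.complexMGF_ofReal, h hx]

/-- The characteristic function of an exponentially tilted measure is the normalized complex
moment generating function along a vertical line. -/
theorem charFun_tilted_mul (μ : Measure ℝ) (c t : ℝ) :
    charFun (μ.tilted (c * ·)) t
      = (ProbabilityTheory.mgf id μ c)⁻¹ • ProbabilityTheory.complexMGF id μ (c + t * Complex.I) := by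
  rw [charFun_apply_real, integral_tilted, ProbabilityTheory.complexMGF, ← integral_smul]
  congr with x
  simp only [ProbabilityTheory.mgf, id_eq, Complex.real_smul, Complex.ofReal_div,
    Complex.ofReal_inv, Complex.ofReal_exp, Complex.ofReal_mul, add_mul, Complex.exp_add]
  ring_nf

/-- Finite-interval uniqueness theorem for moment generating functions: two Borel
probability measures on `ℝ` whose mgfs are finite and agree on a nonempty open interval
`(a,b)` (not necessarily containing `0`) are equal. -/
theorem measure_eq_of_mgf_eq_on_Ioo
    (μ ν : Measure ℝ) (hμ : IsProbabilityMeasure μ) (hν : IsProbabilityMeasure ν)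
    (a b : ℝ) (hab : a < b)
    (hμfin : ∀ t ∈ Ioo a b, Integrable (fun x => Real.exp (t * x)) μ)
    (hνfin : ∀ t ∈ Ioo a b, Integrable (fun x => Real.exp (t * x)) ν)
    (heq : ∀ t ∈ Ioo a b,
      (∫ x, Real.exp (t * x) ∂μ) = ∫ x, Real.exp (t * x) ∂ν) :
    μ = ν := by
  obtain ⟨c, hc⟩ := nonempty_Ioo.mpr hab
  have h_tilted : μ.tilted (c * ·) = ν.tilted (c * ·) := by
    refine Measure.ext_of_charFun (funext fun t ↦ ?_)
    have h_mgf : ProbabilityTheory.mgf id μ c = ProbabilityTheory.mgf id ν c := heq c hc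
    rw [charFun_tilted_mul, charFun_tilted_mul, h_mgf,
      eqOn_complexMGF_of_eqOn_mgf_Ioo (X := id) (Y := id) hμfin hνfin heq (by simpa using hc)]
  rw [← tilted_neg_same (hμfin c hc), h_tilted, tilted_neg_same (hνfin c hc)]
end
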